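/- Let A = σ(R)⟨x_1,…,x_n⟩ be a skew PBW extension of a ring R. If R is Σ-rigid, then A is a reduced ring (A has no non-zero nilpotent elements). -/

import Mathlib

/-! Basic annihilator-condition definitions for (noncommutative) rings. -/

/-- The right annihilator `r_S(X) = {a ∈ S | Xa = 0}` of a subset `X` of a ring `S`. -/
def rAnn {S : Type*} [Ring S] (X : Set S) : Set S := {a | ∀ x ∈ X, x * a = 0}

/-- The left annihilator `ℓ_S(X) = {a ∈ S | aX = 0}` of a subset `X` of a ring `S`. -/
def lAnn {S : Type*} [Ring S] (X : Set S) : Set S := {a | ∀ x ∈ X, a * x = 0}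

/-- The principal right ideal `xS` of a ring `S`. -/
def rIdeal {S : Type*} [Ring S] (x : S) : Set S := Set.range fun s => x * s

/-- The principal left ideal `Sx` of a ring `S`. -/
def lIdeal {S : Type*} [Ring S] (x : S) : Set S := Set.range fun s => s * x

/-- A ring `S` is Baer if the right annihilator of every nonempty subset is
generated (as a right ideal) by an idempotent. -/
def IsBaerRing (S : Type*) [Ring S] : Prop :=
  ∀ X : Set S, X.Nonempty → ∃ e : S, e * e = e ∧ rAnn X = rIdeal e

/-- A ring `S` is a right p.p.-ring if the right annihilator of every element is
generated by an idempotent. -/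
def IsRightPP (S : Type*) [Ring S] : Prop :=
  ∀ a : S, ∃ e : S, e * e = e ∧ rAnn {a} = rIdeal e

/-- A ring `S` is a left p.p.-ring if the left annihilator of every element is
generated by an idempotent. -/
def IsLeftPP (S : Type*) [Ring S] : Prop :=
  ∀ a : S, ∃ e : S, e * e = e ∧ lAnn {a} = lIdeal e

/-- A ring `S` is right p.q.-Baer if the right annihilator of every principal right
ideal is generated by an idempotent. -/
def IsRightPQBaer (S : Type*) [Ring S] : Prop :=
  ∀ a : S, ∃ e : S, e * e = e ∧ rAnn (rIdeal a) = rIdeal e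

/-- A ring `S` is left p.q.-Baer if the left annihilator of every principal left
ideal is generated by an idempotent. -/
def IsLeftPQBaer (S : Type*) [Ring S] : Prop :=
  ∀ a : S, ∃ e : S, e * e = e ∧ lAnn (lIdeal a) = lIdeal e

/-- Property (a.c.) on the right: for every finitely generated right ideal
`I = a₁S + ⋯ + a_mS` there is `c` with `r_S(I) = r_S(cS)`. -/
def HasRightAC (S : Type*) [Ring S] : Prop :=
  ∀ (m : ℕ) (a : Fin m → S), ∃ c : S,
    rAnn {y : S | ∃ s : Fin m → S, y = ∑ i, a i * s i} = rAnn (rIdeal c)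

/-- Property (a.c.) on the left: for every finitely generated left ideal
`I = Sa₁ + ⋯ + Sa_m` there is `c` with `ℓ_S(I) = ℓ_S(Sc)`. -/
def HasLeftAC (S : Type*) [Ring S] : Prop :=
  ∀ (m : ℕ) (a : Fin m → S), ∃ c : S,
    lAnn {y : S | ∃ s : Fin m → S, y = ∑ i, s i * a i} = lAnn (lIdeal c)

/-- A ring is Abelian if every idempotent is central. -/
def IsAbelianRing (S : Type*) [Ring S] : Prop :=
  ∀ e : S, e * e = e → ∀ r : S, e * r = r * e

/-- A ring `S` is NI if the set of nilpotent elements coincides with the upper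
nilradical `nil*(S)`, the sum of all (two-sided) nil ideals of `S`. -/
def IsNIRing (S : Type*) [Ring S] : Prop :=
  {a : S | IsNilpotent a} =
    ((sSup {I : TwoSidedIdeal S | ∀ x ∈ I, IsNilpotent x} : TwoSidedIdeal S) : Set S)

/-- `σ^α = σ₁^{α₁} ∘ ⋯ ∘ σₙ^{αₙ}` for a family of ring endomorphisms. -/
def sigmaPow {R : Type*} [Ring R] {n : ℕ} (σ : Fin n → R →+* R) (α : Fin n → ℕ) : R → R :=
  (List.ofFn fun i => (⇑(σ i))^[α i]).foldr (· ∘ ·) id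

/-- `δ^α = δ₁^{α₁} ∘ ⋯ ∘ δₙ^{αₙ}` for a family of maps. -/
def deltaPow {R : Type*} {n : ℕ} (δ : Fin n → R → R) (α : Fin n → ℕ) : R → R :=
  (List.ofFn fun i => (δ i)^[α i]).foldr (· ∘ ·) id

/-- The ordered standard monomial `x^α = x₁^{α₁} ⋯ xₙ^{αₙ}`. -/
def monom {A : Type*} [Ring A] {n : ℕ} (x : Fin n → A) (α : Fin n → ℕ) : A :=
  (List.ofFn fun i => x i ^ α i).prod

/-- A skew PBW extension `A = σ(R)⟨x₁,…,xₙ⟩` of a ring `R`: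
`R` embeds in `A` (sharing the identity), `A` is a free left `R`-module with basis the
standard monomials, there are injective endomorphisms `σᵢ` and `σᵢ`-derivations `δᵢ`
with `xᵢ r = σᵢ(r) xᵢ + δᵢ(r)`, and `xⱼxᵢ - d_{i,j} xᵢxⱼ ∈ R + Rx₁ + ⋯ + Rxₙ`
with `d_{i,j} ≠ 0`. -/
structure SkewPBWExt (R A : Type*) [Ring R] [Ring A] (n : ℕ) where
  /-- the inclusion of `R` into `A` -/
  ι : R →+* A
  ι_inj : Function.Injective ι
  /-- the variables `x₁, …, xₙ` -/
  x : Fin n → A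
  /-- the endomorphisms `σᵢ` -/
  σ : Fin n → R →+* R
  σ_inj : ∀ i, Function.Injective (σ i)
  /-- the `σᵢ`-derivations `δᵢ` -/
  δ : Fin n → R → R
  δ_add : ∀ (i : Fin n) (a b : R), δ i (a + b) = δ i a + δ i b
  δ_leibniz : ∀ (i : Fin n) (a b : R), δ i (a * b) = σ i a * δ i b + δ i a * b
  comm_rel : ∀ (i : Fin n) (r : R), x i * ι r = ι (σ i r) * x i + ι (δ i r)
  /-- `A` is a free left `R`-module with basis the standard monomials: every element
  has a unique representation as a finite left `R`-linear combination of monomials. -/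
  basis : ∀ f : A, ∃! c : (Fin n → ℕ) →₀ R, f = c.sum fun α r => ι r * monom x α
  /-- the constants `d_{i,j}` -/
  d : Fin n → Fin n → R
  d_ne : ∀ i j, d i j ≠ 0
  quad : ∀ i j, ∃ (r0 : R) (rc : Fin n → R),
    x j * x i - ι (d i j) * (x i * x j) = ι r0 + ∑ k, ι (rc k) * x k

namespace SkewPBWExt

variable {R A : Type*} [Ring R] [Ring A] {n : ℕ}

/-- `R` is `(Σ,Δ)`-compatible. -/
def SigmaDeltaCompatible (E : SkewPBWExt R A n) : Prop :=
  ∀ (a b : R) (α : Fin n → ℕ),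
    (a * b = 0 ↔ a * sigmaPow E.σ α b = 0) ∧ (a * b = 0 → a * deltaPow E.δ α b = 0)

/-- `R` is `Σ`-rigid. -/
def SigmaRigid (E : SkewPBWExt R A n) : Prop :=
  ∀ (a : R) (α : Fin n → ℕ), a * sigmaPow E.σ α a = 0 → a = 0

/-- Condition (SA1): if `fg = 0` in `A` then all products of coefficients vanish. -/
def SA1 (E : SkewPBWExt R A n) : Prop :=
  ∀ cf cg : (Fin n → ℕ) →₀ R,
    (cf.sum fun α r => E.ι r * monom E.x α) * (cg.sum fun β r => E.ι r * monom E.x β) = 0 →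
    ∀ α β, cf α * cg β = 0

/-- The extension is bijective: every `σᵢ` is bijective and every `d_{i,j}` (`i < j`)
is invertible in `R`. -/
def Bijective (E : SkewPBWExt R A n) : Prop :=
  (∀ i, Function.Bijective (E.σ i)) ∧ ∀ i j : Fin n, i < j → IsUnit (E.d i j)

end SkewPBWExt


namespace SkewPBWExt

section Lemmas

variable {R A : Type*} [Ring R] [Ring A] {n : ℕ}

theorem monom_eq_map_finRange (x : Fin n → A) (α : Fin n → ℕ) :
    monom x α = ((List.finRange n).map fun i => x i ^ α i).prod := by
  rw [monom, List.ofFn_eq_map]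

theorem monom_zero (x : Fin n → A) : monom x 0 = 1 := by
  simp [monom_eq_map_finRange]

/-- Multiplying a sorted product of powers on the left by a variable that precedes all the
variables occurring in it. -/
theorem mul_prod_map_pow (x : Fin n → A) (α : Fin n → ℕ) (i : Fin n)
    (h : ∀ j < i, α j = 0) (l : List (Fin n)) (hl : l.Pairwise (· < ·)) (hi : i ∈ l) :
    x i * (l.map fun k => x k ^ α k).prod =
      (l.map fun k => x k ^ (Pi.single i 1 + α : Fin n → ℕ) k).prod := by
  induction l with
  | nil => simp at hi
  | cons k l ih =>
    rw [List.pairwise_cons] at hl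
    rw [List.map_cons, List.prod_cons, List.map_cons, List.prod_cons]
    by_cases hk : i = k
    · subst hk
      have hmap : (l.map fun k => x k ^ (Pi.single i 1 + α : Fin n → ℕ) k) =
          l.map fun k => x k ^ α k := by
        refine List.map_congr_left fun k hk => ?_
        simp [(hl.1 k hk).ne']
      rw [hmap, ← mul_assoc]
      simp [pow_add]
    · have hil : i ∈ l := (List.mem_cons.1 hi).resolve_left hk
      have hki : k < i := hl.1 i hil
      rw [← ih hl.2 hil]
      simp [h k hki, hki.ne]

theorem mul_monom (x : Fin n → A) (α : Fin n → ℕ) (i : Fin n) (h : ∀ j < i, α j = 0) :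
    x i * monom x α = monom x (Pi.single i 1 + α) := by
  rw [monom_eq_map_finRange, monom_eq_map_finRange]
  exact mul_prod_map_pow x α i h _ (List.pairwise_lt_finRange n) (List.mem_finRange i)

theorem monom_single (x : Fin n → A) (i : Fin n) : monom x (Pi.single i 1) = x i := by
  have h := mul_monom x 0 i fun _ _ => rfl
  rw [monom_zero, mul_one, add_zero] at h
  exact h.symm

/-- The total degree of an exponent vector. -/
def totalDeg (α : Fin n → ℕ) : ℕ := ∑ i, α i

theorem totalDeg_add (α β : Fin n → ℕ) : totalDeg (α + β) = totalDeg α + totalDeg β := by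
  simp [totalDeg, Finset.sum_add_distrib]

theorem totalDeg_single (i : Fin n) (k : ℕ) : totalDeg (Pi.single i k) = k := by
  simp [totalDeg]

/-- Among the exponents of maximal total degree, one maximizing the sum of squares is extremal:
it is a midpoint of two exponents only trivially. -/
theorem exists_extremal (S : Finset (Fin n → ℕ)) (hS : S.Nonempty) :
    ∃ α ∈ S, (∀ β ∈ S, totalDeg β ≤ totalDeg α) ∧
      ∀ β ∈ S, ∀ γ ∈ S, β + γ = α + α → β = α ∧ γ = α := by
  obtain ⟨μ, hμ, hmax⟩ := S.exists_max_image totalDeg hS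
  obtain ⟨α, hα, hsq⟩ := (S.filter fun β => totalDeg β = totalDeg μ).exists_max_image
    (fun β => ∑ i, β i ^ 2) ⟨μ, by simp [hμ]⟩
  rw [Finset.mem_filter] at hα
  refine ⟨α, hα.1, fun β hβ => hα.2 ▸ hmax β hβ, fun β hβ γ hγ h => ?_⟩
  have hdeg : totalDeg β + totalDeg γ = totalDeg μ + totalDeg μ := by
    rw [← totalDeg_add, h, totalDeg_add, hα.2]
  have hβμ := hmax β hβ
  have hγμ := hmax γ hγ
  have h1 := hsq β (Finset.mem_filter.2 ⟨hβ, by lia⟩)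
  have h2 := hsq γ (Finset.mem_filter.2 ⟨hγ, by lia⟩)
  have hpt : ∀ i, (β i : ℤ) + γ i = α i + α i := fun i => by exact_mod_cast congrFun h i
  have hsum : ∑ i, (((β i : ℤ) - α i) ^ 2 + ((γ i : ℤ) - α i) ^ 2) ≤ 0 := by
    have heq : ∑ i, (((β i : ℤ) - α i) ^ 2 + ((γ i : ℤ) - α i) ^ 2) =
        ∑ i, (β i : ℤ) ^ 2 + ∑ i, (γ i : ℤ) ^ 2 - ∑ i, (α i : ℤ) ^ 2 - ∑ i, (α i : ℤ) ^ 2 := by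
      rw [← Finset.sum_add_distrib, ← Finset.sum_sub_distrib, ← Finset.sum_sub_distrib]
      exact Finset.sum_congr rfl fun i _ => by linear_combination (-2 * (α i : ℤ)) * hpt i
    zify at h1 h2
    lia
  have hzero := (Finset.sum_eq_zero_iff_of_nonneg fun i _ => by positivity).1
    (le_antisymm hsum (Finset.sum_nonneg fun i _ => by positivity))
  constructor <;> funext i <;> have hi := hzero i (Finset.mem_univ i)
  · have := pow_eq_zero_iff (two_ne_zero) |>.1 (show ((β i : ℤ) - α i) ^ 2 = 0 by
        nlinarith [sq_nonneg ((β i : ℤ) - α i), sq_nonneg ((γ i : ℤ) - α i)])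
    lia
  · have := pow_eq_zero_iff (two_ne_zero) |>.1 (show ((γ i : ℤ) - α i) ^ 2 = 0 by
        nlinarith [sq_nonneg ((β i : ℤ) - α i), sq_nonneg ((γ i : ℤ) - α i)])
    lia

/-- In a ring whose square-zero elements vanish, one-sided inverses are two-sided. -/
theorem mul_eq_one_symm_of_sq_eq_zero (hred : ∀ a : R, a * a = 0 → a = 0) {a b : R}
    (h : a * b = 1) : b * a = 1 := by
  have h0 : b * (1 - b * a) = 0 := by
    apply hred
    have : (1 - b * a) * b = 0 := by rw [sub_mul, one_mul, mul_assoc, h, mul_one, sub_self]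
    rw [mul_assoc, ← mul_assoc _ b, this, zero_mul, mul_zero]
  have h1 : 1 - b * a = 0 := by
    calc 1 - b * a = a * b * (1 - b * a) := by rw [h, one_mul]
      _ = 0 := by rw [mul_assoc, h0, mul_zero]
  exact (sub_eq_zero.1 h1).symm

variable (E : SkewPBWExt R A n)

/-- The additive isomorphism between finitely supported coefficient families and `A`. -/
noncomputable def coeffEquiv : ((Fin n → ℕ) →₀ R) ≃+ A :=
  AddEquiv.ofBijective
    (Finsupp.liftAddHom fun α => (AddMonoidHom.mulRight (monom E.x α)).comp E.ι.toAddMonoidHom)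
    ((Function.bijective_iff_existsUnique _).2 fun f => by
      obtain ⟨c, hc, huniq⟩ := E.basis f
      exact ⟨c, hc.symm, fun c' hc' => huniq c' hc'.symm⟩)

theorem coeffEquiv_apply (c : (Fin n → ℕ) →₀ R) :
    E.coeffEquiv c = c.sum fun α r => E.ι r * monom E.x α := rfl

/-- The coefficient of the standard monomial with exponent `γ`. -/
noncomputable def coeff (γ : Fin n → ℕ) : A →+ R :=
  (Finsupp.applyAddHom γ).comp E.coeffEquiv.symm.toAddMonoidHom

theorem coeff_mul_monom (γ α : Fin n → ℕ) (r : R) :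
    E.coeff γ (E.ι r * monom E.x α) = if α = γ then r else 0 := by
  have h : E.ι r * monom E.x α = E.coeffEquiv (Finsupp.single α r) := by
    rw [coeffEquiv_apply, Finsupp.sum_single_index (by simp)]
  rw [h]
  simp [coeff, Finsupp.single_apply]

/-- The left `R`-span of the standard monomials of total degree less than `m`. -/
def degLT (m : ℕ) : AddSubgroup A :=
  AddSubgroup.closure {f | ∃ (r : R) (α : Fin n → ℕ), totalDeg α < m ∧ f = E.ι r * monom E.x α}

theorem mul_monom_mem_degLT {m : ℕ} (r : R) {α : Fin n → ℕ} (h : totalDeg α < m) :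
    E.ι r * monom E.x α ∈ E.degLT m :=
  AddSubgroup.subset_closure ⟨r, α, h, rfl⟩

theorem monom_mem_degLT {m : ℕ} {α : Fin n → ℕ} (h : totalDeg α < m) :
    monom E.x α ∈ E.degLT m := by
  simpa using E.mul_monom_mem_degLT 1 h

/-- An additive map sends `degLT m` into a subgroup as soon as it does so on the generators. -/
theorem map_mem_of_mem_degLT {B : Type*} [AddGroup B] {m : ℕ} (φ : A →+ B) (H : AddSubgroup B)
    (h : ∀ (r : R) (α : Fin n → ℕ), totalDeg α < m → φ (E.ι r * monom E.x α) ∈ H)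
    {f : A} (hf : f ∈ E.degLT m) : φ f ∈ H := by
  have hle : E.degLT m ≤ H.comap φ := by
    rw [degLT, AddSubgroup.closure_le]
    rintro _ ⟨r, α, hα, rfl⟩
    exact h r α hα
  exact hle hf

theorem degLT_mono {m k : ℕ} (hmk : m ≤ k) {f : A} (hf : f ∈ E.degLT m) : f ∈ E.degLT k :=
  E.map_mem_of_mem_degLT (AddMonoidHom.id A) _
    (fun r _ hα => E.mul_monom_mem_degLT r (hα.trans_le hmk)) hf

theorem ι_mul_mem_degLT {m : ℕ} (s : R) {f : A} (hf : f ∈ E.degLT m) :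
    E.ι s * f ∈ E.degLT m := by
  refine E.map_mem_of_mem_degLT (AddMonoidHom.mulLeft (E.ι s)) _ (fun r α hα => ?_) hf
  rw [AddMonoidHom.coe_mulLeft, ← mul_assoc, ← map_mul]
  exact E.mul_monom_mem_degLT _ hα

theorem coeff_eq_zero {m : ℕ} {γ : Fin n → ℕ} (hγ : m ≤ totalDeg γ) {f : A}
    (hf : f ∈ E.degLT m) : E.coeff γ f = 0 := by
  refine (AddSubgroup.mem_bot).1 (E.map_mem_of_mem_degLT (E.coeff γ) ⊥ (fun r α hα => ?_) hf)
  rw [coeff_mul_monom, if_neg, AddSubgroup.mem_bot]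
  rintro rfl
  lia

theorem x_mul_ι_mul (i : Fin n) (r : R) (f : A) :
    E.x i * (E.ι r * f) = E.ι (E.σ i r) * (E.x i * f) + E.ι (E.δ i r) * f := by
  rw [← mul_assoc, E.comm_rel, add_mul, mul_assoc]

/-- The right-hand side of the quadratic relations, times a monomial of degree `m`, stays in
degree at most `m + 1`. -/
theorem quad_mem_degLT (i j : Fin n) {m : ℕ} {f : A} (hf : f ∈ E.degLT m)
    (hx : ∀ k, E.x k * f ∈ E.degLT m) :
    E.x j * (E.x i * f) - E.ι (E.d i j) * (E.x i * (E.x j * f)) ∈ E.degLT m := by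
  obtain ⟨r, c, h⟩ := E.quad i j
  have heq : E.x j * (E.x i * f) - E.ι (E.d i j) * (E.x i * (E.x j * f)) =
      E.ι r * f + ∑ k, E.ι (c k) * (E.x k * f) := by
    simp only [← mul_assoc]
    rw [← Finset.sum_mul, ← add_mul, ← h, sub_mul, ← mul_assoc]
  rw [heq]
  exact add_mem (E.ι_mul_mem_degLT r hf) (sum_mem fun k _ => E.ι_mul_mem_degLT _ (hx k))

theorem isUnit_d (hred : ∀ a : R, a * a = 0 → a = 0) {i j : Fin n} (hij : i < j) :
    IsUnit (E.d i j) := by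
  have h1 : (1 : A) ∈ E.degLT 2 := by
    rw [← monom_zero E.x]
    exact E.monom_mem_degLT (by simp [totalDeg])
  have hx : ∀ k, E.x k * 1 ∈ E.degLT 2 := fun k => by
    rw [mul_one, ← monom_single E.x k]
    exact E.monom_mem_degLT (by simp [totalDeg_single])
  have hm : E.x i * E.x j = monom E.x (Pi.single i 1 + Pi.single j 1) := by
    rw [← monom_single E.x j, mul_monom _ _ _ fun k hk => by simp [(hk.trans hij).ne]]
  have hdeg : totalDeg (Pi.single i 1 + Pi.single j 1 : Fin n → ℕ) = 2 := by
    rw [totalDeg_add, totalDeg_single, totalDeg_single]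
  have ha := E.quad_mem_degLT i j h1 hx
  have hb := E.quad_mem_degLT j i h1 hx
  simp only [mul_one] at ha hb
  have hc := E.coeff_eq_zero hdeg.ge (add_mem hb (E.ι_mul_mem_degLT (E.d j i) ha))
  rw [mul_sub, ← mul_assoc (E.ι _) (E.ι _), ← map_mul, sub_add_sub_cancel, hm, map_sub,
    coeff_mul_monom, if_pos rfl, ← one_mul (monom _ _), ← map_one E.ι, coeff_mul_monom,
    if_pos rfl] at hc
  have hleft : E.d j i * E.d i j = 1 := (sub_eq_zero.1 hc).symm
  exact ⟨⟨_, _, mul_eq_one_symm_of_sq_eq_zero hred hleft, hleft⟩, rfl⟩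

theorem x_mul_mem_degLT {m : ℕ}
    (h : ∀ β : Fin n → ℕ, totalDeg β < m → ∀ i, E.x i * monom E.x β ∈ E.degLT (m + 1))
    (i : Fin n) {f : A} (hf : f ∈ E.degLT m) : E.x i * f ∈ E.degLT (m + 1) := by
  refine E.map_mem_of_mem_degLT (AddMonoidHom.mulLeft (E.x i)) _ (fun r α hα => ?_) hf
  rw [AddMonoidHom.coe_mulLeft, x_mul_ι_mul]
  exact add_mem (E.ι_mul_mem_degLT _ (h α hα i)) (E.mul_monom_mem_degLT _ (by lia))

theorem mem_degLT_of_sub_mem {m : ℕ} {f : A} {r : R} {α : Fin n → ℕ} (hα : totalDeg α < m)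
    (h : f - E.ι r * monom E.x α ∈ E.degLT m) : f ∈ E.degLT m := by
  simpa using add_mem h (E.mul_monom_mem_degLT r hα)

/-- Up to terms of lower degree, `xᵢ x^α` is a unit multiple of `x^{eᵢ+α}`. -/
theorem exists_isUnit_x_mul_monom (hred : ∀ a : R, a * a = 0 → a = 0) (α : Fin n → ℕ)
    (i : Fin n) :
    ∃ u : R, IsUnit u ∧
      E.x i * monom E.x α - E.ι u * monom E.x (Pi.single i 1 + α) ∈ E.degLT (totalDeg α + 1) := by
  induction hm : totalDeg α using Nat.strong_induction_on generalizing α i with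
  | _ m ih =>
  have hmem : ∀ β : Fin n → ℕ, totalDeg β < m → ∀ i, E.x i * monom E.x β ∈ E.degLT (m + 1) := by
    intro β hβ i
    obtain ⟨u, -, hu⟩ := ih _ hβ β i rfl
    refine E.mem_degLT_of_sub_mem (α := Pi.single i 1 + β) (r := u) ?_
      (E.degLT_mono (by lia) hu)
    rw [totalDeg_add, totalDeg_single]
    lia
  by_cases h : ∀ j < i, α j = 0
  · exact ⟨1, isUnit_one, by simp [mul_monom E.x α i h, zero_mem]⟩
  · obtain ⟨j, ⟨hji, hj⟩, hmin⟩ : ∃ j, (j < i ∧ α j ≠ 0) ∧ ∀ k < j, α k = 0 := by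
      push Not at h
      obtain ⟨j, hj, hmin⟩ := WellFounded.has_min (wellFounded_lt (α := Fin n))
        {j | j < i ∧ α j ≠ 0} h
      refine ⟨j, hj, fun k hk => ?_⟩
      by_contra hne
      exact hmin k ⟨hk.trans hj.1, hne⟩ hk
    obtain ⟨β, rfl⟩ : ∃ β : Fin n → ℕ, α = Pi.single j 1 + β := by
      refine ⟨α - Pi.single j 1, funext fun k => ?_⟩
      by_cases hk : k = j
      · subst hk
        simp only [Pi.add_apply, Pi.sub_apply, Pi.single_eq_same]
        lia
      · simp [hk]
    have hβ : ∀ k < j, β k = 0 := fun k hk => by simpa [hk.ne] using hmin k hk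
    rw [totalDeg_add, totalDeg_single] at hm
    obtain ⟨u, hu, hsub⟩ := ih (totalDeg β) (by lia) β i rfl
    have hcomm : E.x j * monom E.x (Pi.single i 1 + β) =
        monom E.x (Pi.single i 1 + (Pi.single j 1 + β)) := by
      rw [mul_monom, add_left_comm]
      intro k hk
      simp [hβ k hk, (hk.trans hji).ne]
    have hq : E.x i * (E.x j * monom E.x β) - E.ι (E.d j i) * (E.x j * (E.x i * monom E.x β)) ∈
        E.degLT (m + 1) :=
      E.quad_mem_degLT j i (E.monom_mem_degLT (by lia)) (hmem β (by lia))
    have hxj := E.x_mul_mem_degLT hmem j (E.degLT_mono (by lia) hsub)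
    have hδ : E.ι (E.δ j u) * monom E.x (Pi.single i 1 + β) ∈ E.degLT (m + 1) :=
      E.mul_monom_mem_degLT _ (by rw [totalDeg_add, totalDeg_single]; lia)
    refine ⟨E.d j i * E.σ j u, (E.isUnit_d hred hji).mul (hu.map _), ?_⟩
    have hres := add_mem hq (E.ι_mul_mem_degLT (E.d j i) (add_mem hxj hδ))
    rw [mul_sub, x_mul_ι_mul, hcomm, sub_add_eq_sub_sub, sub_add_cancel, mul_sub,
      sub_add_sub_cancel, mul_monom E.x β j hβ, ← mul_assoc, ← map_mul] at hres
    exact hres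

/-- Left multiplication by `y` acts on leading terms, up to units, as the twist by `s` followed by
the shift of exponents by `α`. -/
def ActsOnLeadingTerms (y : A) (s : R →+* R) (α : Fin n → ℕ) : Prop :=
  ∀ (r : R) (β : Fin n → ℕ), ∃ u : R, IsUnit u ∧
    y * (E.ι r * monom E.x β) - E.ι (s r * u) * monom E.x (α + β) ∈
      E.degLT (totalDeg α + totalDeg β)

variable {E}

theorem ActsOnLeadingTerms.mul_mem_degLT {y : A} {s : R →+* R} {α : Fin n → ℕ}
    (h : E.ActsOnLeadingTerms y s α) {m : ℕ} {f : A} (hf : f ∈ E.degLT m) :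
    y * f ∈ E.degLT (totalDeg α + m) := by
  refine E.map_mem_of_mem_degLT (AddMonoidHom.mulLeft y) _ (fun r β hβ => ?_) hf
  obtain ⟨u, -, hu⟩ := h r β
  refine E.mem_degLT_of_sub_mem ?_ (E.degLT_mono (by lia) hu)
  rw [totalDeg_add]
  lia

theorem ActsOnLeadingTerms.one : E.ActsOnLeadingTerms 1 1 0 := fun r β =>
  ⟨1, isUnit_one, by simp [zero_mem]⟩

theorem ActsOnLeadingTerms.mul {y y' : A} {s s' : R →+* R} {α α' : Fin n → ℕ}
    (h : E.ActsOnLeadingTerms y s α) (h' : E.ActsOnLeadingTerms y' s' α') :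
    E.ActsOnLeadingTerms (y * y') (s * s') (α + α') := by
  intro r β
  obtain ⟨u', hu', hsub'⟩ := h' r β
  obtain ⟨u, hu, hsub⟩ := h (s' r * u') (α' + β)
  refine ⟨s u' * u, (hu'.map s).mul hu, ?_⟩
  have hres := add_mem (h.mul_mem_degLT hsub')
    (E.degLT_mono (by rw [totalDeg_add]) hsub)
  rw [mul_sub, sub_add_sub_cancel, map_mul s, mul_assoc, ← add_assoc α, ← mul_assoc y,
    ← add_assoc (totalDeg α), ← totalDeg_add] at hres
  exact hres

theorem ActsOnLeadingTerms.x (hred : ∀ a : R, a * a = 0 → a = 0) (i : Fin n) :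
    E.ActsOnLeadingTerms (E.x i) (E.σ i) (Pi.single i 1) := by
  intro r β
  obtain ⟨u, hu, hsub⟩ := E.exists_isUnit_x_mul_monom hred β i
  refine ⟨u, hu, ?_⟩
  have hres := add_mem (E.ι_mul_mem_degLT (E.σ i r) hsub)
    (E.mul_monom_mem_degLT (E.δ i r) (Nat.lt_succ_self (totalDeg β)))
  rw [mul_sub, sub_add_eq_add_sub, ← x_mul_ι_mul, ← mul_assoc (E.ι _) (E.ι _), ← map_mul] at hres
  rwa [totalDeg_single, add_comm 1]

theorem ActsOnLeadingTerms.pow {y : A} {s : R →+* R} {α : Fin n → ℕ}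
    (h : E.ActsOnLeadingTerms y s α) (k : ℕ) : E.ActsOnLeadingTerms (y ^ k) (s ^ k) (k • α) := by
  induction k with
  | zero => simpa using ActsOnLeadingTerms.one
  | succ k ih =>
    rw [pow_succ, pow_succ, succ_nsmul]
    exact ih.mul h

theorem ActsOnLeadingTerms.list_prod {ι : Type*} {y : ι → A} {s : ι → R →+* R}
    {α : ι → Fin n → ℕ} (h : ∀ i, E.ActsOnLeadingTerms (y i) (s i) (α i)) (l : List ι) :
    E.ActsOnLeadingTerms (l.map y).prod (l.map s).prod (l.map α).sum := by
  induction l with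
  | nil => simpa using ActsOnLeadingTerms.one
  | cons i l ih => simpa using (h i).mul ih

variable (E)

theorem sigmaPow_eq_list_prod (α : Fin n → ℕ) :
    sigmaPow E.σ α = ⇑((List.finRange n).map fun i => E.σ i ^ α i).prod := by
  rw [sigmaPow, List.ofFn_eq_map]
  induction List.finRange n with
  | nil => rfl
  | cons i l ih =>
    rw [List.map_cons, List.foldr_cons, ih, List.map_cons, List.prod_cons, RingHom.coe_mul,
      RingHom.coe_pow]

theorem exists_isUnit_monom_mul (hred : ∀ a : R, a * a = 0 → a = 0) (α β : Fin n → ℕ) (r : R) :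
    ∃ u : R, IsUnit u ∧
      monom E.x α * (E.ι r * monom E.x β) - E.ι (sigmaPow E.σ α r * u) * monom E.x (α + β) ∈
        E.degLT (totalDeg α + totalDeg β) := by
  have h := ActsOnLeadingTerms.list_prod
    (fun i => (ActsOnLeadingTerms.x (E := E) hred i).pow (α i)) (List.finRange n)
  have hsum : ((List.finRange n).map fun i => α i • (Pi.single i 1 : Fin n → ℕ)).sum = α := by
    rw [← List.ofFn_eq_map, List.sum_ofFn]
    simp only [← Pi.single_smul, smul_eq_mul, mul_one]
    exact Finset.univ_sum_single α
  rw [hsum, ← monom_eq_map_finRange] at h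
  rw [sigmaPow_eq_list_prod]
  exact h r β

end Lemmas

end SkewPBWExt

/-- If `R` is `Σ`-rigid, then the skew PBW extension `A` is a reduced ring. -/
theorem sigmaRigid_isReduced {R A : Type*} [Ring R] [Ring A] {n : ℕ} (E : SkewPBWExt R A n)
    (hrig : E.SigmaRigid) :
    IsReduced A := by
  have hred : ∀ a : R, a * a = 0 → a = 0 := by
    intro a ha
    refine hrig a 0 ?_
    have h0 : sigmaPow E.σ 0 a = a := by simp [SkewPBWExt.sigmaPow_eq_list_prod]
    rwa [h0]
  refine (isReduced_iff_pow_one_lt 2 one_lt_two).2 fun f hf => ?_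
  obtain ⟨c, rfl⟩ := E.coeffEquiv.surjective f
  by_contra hne
  have hc : c ≠ 0 := fun h => hne (by rw [h, map_zero])
  obtain ⟨α, hα, hdeg, hext⟩ :=
    SkewPBWExt.exists_extremal c.support (Finsupp.support_nonempty_iff.2 hc)
  have hterm : ∀ β ∈ c.support, ∀ γ ∈ c.support, ∃ u : R, IsUnit u ∧
      E.coeff (α + α) (E.ι (c β) * monom E.x β * (E.ι (c γ) * monom E.x γ)) =
        if β + γ = α + α then c β * sigmaPow E.σ β (c γ) * u else 0 := by
    intro β hβ γ hγ
    obtain ⟨u, hu, hsub⟩ := E.exists_isUnit_monom_mul hred β γ (c γ)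
    refine ⟨u, hu, ?_⟩
    have hle : SkewPBWExt.totalDeg β + SkewPBWExt.totalDeg γ ≤ SkewPBWExt.totalDeg (α + α) := by
      rw [SkewPBWExt.totalDeg_add]
      exact add_le_add (hdeg β hβ) (hdeg γ hγ)
    have hz := E.coeff_eq_zero hle (E.ι_mul_mem_degLT (c β) hsub)
    rw [mul_sub, map_sub, sub_eq_zero, ← mul_assoc (E.ι _) (E.ι _), ← map_mul,
      SkewPBWExt.coeff_mul_monom, ← mul_assoc (c β)] at hz
    rw [mul_assoc, hz]
  have hsq : E.coeff (α + α) (E.coeffEquiv c ^ 2) =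
      E.coeff (α + α) (E.ι (c α) * monom E.x α * (E.ι (c α) * monom E.x α)) := by
    rw [pow_two, SkewPBWExt.coeffEquiv_apply, Finsupp.sum, Finset.sum_mul_sum, map_sum,
      Finset.sum_eq_single_of_mem α hα, map_sum, Finset.sum_eq_single_of_mem α hα]
    · intro γ hγ hγα
      obtain ⟨u, -, h⟩ := hterm α hα γ hγ
      rw [h, if_neg fun heq => hγα (hext α hα γ hγ heq).2]
    · intro β hβ hβα
      rw [map_sum]
      refine Finset.sum_eq_zero fun γ hγ => ?_
      obtain ⟨u, -, h⟩ := hterm β hβ γ hγ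
      rw [h, if_neg fun heq => hβα (hext β hβ γ hγ heq).1]
  obtain ⟨u, hu, h⟩ := hterm α hα α hα
  rw [hf, map_zero, h, if_pos rfl] at hsq
  exact Finsupp.mem_support_iff.1 hα (hrig (c α) α (hu.mul_left_eq_zero.1 hsq.symm))
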